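/- arXiv:math/0611957 — 2 statements merged into one kernel-verified Lean document; each statement's English description precedes it below -/
import Mathlib

section
/- There exist absolute positive constants C₁ and C₂ such that the following holds. Let U be an n×n real matrix with UᵀU = n·I and coherence μ(U) = max_{k,j} |U_{k,j}|. Fix T ⊆ {1,…,n} and δ ∈ (0,1), and let Ω be a uniformly random subset of {1,…,n} of size m. If m ≥ |T| · μ(U)² · max(C₁ log |T|, C₂ log(3/δ)), then P( ‖ (1/m) U_{ΩT}ᵀ U_{ΩT} − I ‖ ≥ 1/2 ) ≤ δ, where ‖·‖ denotes the spectral (operator ℓ₂) norm and I is the |T|×|T| identity matrix. -/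
open Classical Finset Matrix Real

/-- Spectral (operator ℓ²) norm of a real matrix. -/
noncomputable def specNorm {ι κ : Type*} [Fintype ι] [Fintype κ] [DecidableEq κ]
    (A : Matrix ι κ ℝ) : ℝ :=
  ‖LinearMap.toContinuousLinearMap (Matrix.toEuclideanLin A)‖

/-- Coherence: the largest magnitude among the entries of `U`. -/
noncomputable def coh {n : ℕ} (U : Matrix (Fin n) (Fin n) ℝ) : ℝ :=
  ⨆ k, ⨆ j, |U k j|

/-- Uniform probability of the event `E` on the finite sample space `s`. -/
noncomputable def uprob {α : Type*} (s : Finset α) (E : α → Prop) : ℝ :=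
  ((s.filter E).card : ℝ) / s.card

/-- Weight of the outcome `ω` for i.i.d. Bernoulli(m/n) variables `δ_k = ω k`. -/
noncomputable def bweight (n m : ℕ) (ω : Fin n → Bool) : ℝ :=
  ∏ k, if ω k then (m : ℝ) / n else 1 - (m : ℝ) / n

/-- Expectation under the i.i.d. Bernoulli(m/n) model. -/
noncomputable def bexp (n m : ℕ) (f : (Fin n → Bool) → ℝ) : ℝ :=
  ∑ ω : Fin n → Bool, bweight n m ω * f ω

/-- Probability of an event under the i.i.d. Bernoulli(m/n) model. -/
noncomputable def bprob (n m : ℕ) (E : (Fin n → Bool) → Prop) : ℝ :=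
  ∑ ω : Fin n → Bool, if E ω then bweight n m ω else 0

/-- Euclidean norm of a finitely indexed real vector. -/
noncomputable def l2norm {ι : Type*} [Fintype ι] (v : ι → ℝ) : ℝ :=
  Real.sqrt (∑ i, v i ^ 2)

section TraceInequalities

variable {ι : Type*} [Fintype ι]

lemma trace_transpose_mul_self_nonneg (A : Matrix ι ι ℝ) : 0 ≤ trace (Aᵀ * A) := by
  simp only [trace, diag_apply, mul_apply, transpose_apply]
  exact sum_nonneg fun i _ => sum_nonneg fun j _ => mul_self_nonneg _

lemma trace_vecMulVec_mul_sq {W : Matrix ι ι ℝ} (hW : Wᵀ = W) (v : ι → ℝ) :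
    trace (vecMulVec v v * (W * W)) = (W *ᵥ v) ⬝ᵥ (W *ᵥ v) := by
  rw [← Matrix.mul_assoc, trace_mul_comm, vecMulVec_mul, mul_vecMulVec, trace_vecMulVec,
    ← mulVec_transpose, hW]

variable [DecidableEq ι]

/-- A real symmetric matrix has an orthogonal diagonalization, valid for all of its powers. -/
lemma exists_orthogonal_diagonalization {A : Matrix ι ι ℝ} (hA : Aᵀ = A) :
    ∃ (Q : Matrix ι ι ℝ) (a : ι → ℝ), Q * Qᵀ = 1 ∧ Qᵀ * Q = 1 ∧
      ∀ k : ℕ, A ^ k = Q * diagonal (fun i => a i ^ k) * Qᵀ := by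
  have hH : A.IsHermitian := by rw [IsHermitian, conjTranspose_eq_transpose_of_trivial, hA]
  obtain ⟨Q, a, h1, h2, h3⟩ : ∃ (Q : Matrix ι ι ℝ) (a : ι → ℝ),
      Q * Qᵀ = 1 ∧ Qᵀ * Q = 1 ∧ A = Q * diagonal a * Qᵀ := by
    refine ⟨hH.eigenvectorUnitary, hH.eigenvalues, ?_, ?_, ?_⟩
    · have := Unitary.coe_mul_star_self hH.eigenvectorUnitary
      rwa [Unitary.coe_star, star_eq_conjTranspose, conjTranspose_eq_transpose_of_trivial] at this
    · have := Unitary.coe_star_mul_self hH.eigenvectorUnitary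
      rwa [star_eq_conjTranspose, conjTranspose_eq_transpose_of_trivial] at this
    · have := hH.spectral_theorem
      rwa [Unitary.conjStarAlgAut_apply, star_eq_conjTranspose,
        conjTranspose_eq_transpose_of_trivial] at this
  refine ⟨Q, a, h1, h2, fun k => ?_⟩
  induction k with
  | zero => simp [h1]
  | succ k ih =>
    rw [pow_succ, ih, h3]
    simp only [pow_succ, ← diagonal_mul_diagonal, Matrix.mul_assoc]
    rw [← Matrix.mul_assoc Qᵀ Q, h2, Matrix.one_mul]

/-- Joint spectral weights: mixed traces of powers of two symmetric matrices are nonnegative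
combinations of the corresponding scalar monomials. -/
lemma exists_trace_pow_mul_pow_eq_sum {A B : Matrix ι ι ℝ} (hA : Aᵀ = A) (hB : Bᵀ = B) :
    ∃ (a b : ι → ℝ) (w : ι → ι → ℝ), (∀ i j, 0 ≤ w i j) ∧
      ∀ k l : ℕ, trace (A ^ k * B ^ l) = ∑ i, ∑ j, w i j * (a i ^ k * b j ^ l) := by
  obtain ⟨Q, a, -, -, ha⟩ := exists_orthogonal_diagonalization hA
  obtain ⟨P, b, -, -, hb⟩ := exists_orthogonal_diagonalization hB
  refine ⟨a, b, fun i j => (Qᵀ * P) i j ^ 2, fun i j => sq_nonneg _, fun k l => ?_⟩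
  have h : trace (A ^ k * B ^ l) = trace ((diagonal (fun i => a i ^ k) * (Qᵀ * P)) *
      (diagonal (fun i => b i ^ l) * (Qᵀ * P)ᵀ)) := by
    rw [ha, hb, transpose_mul, transpose_transpose, Matrix.mul_assoc Q, Matrix.mul_assoc Q,
      trace_mul_comm Q]
    simp only [Matrix.mul_assoc]
  rw [h]
  simp only [trace, diag_apply, mul_apply (M := diagonal _ * _), diagonal_mul, transpose_apply]
  exact sum_congr rfl fun i _ => sum_congr rfl fun j _ => by ring

lemma sub_mul_pow_sub_pow_le (p : ℕ) (a b : ℝ) :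
    (a - b) * (a ^ (2 * p + 1) - b ^ (2 * p + 1)) ≤
      (2 * p + 1) / 2 * ((a - b) ^ 2 * (a ^ (2 * p) + b ^ (2 * p))) := by
  have hs : (∑ i ∈ range (2 * p + 1), a ^ i * b ^ (2 * p - i)) * 2 ≤
      (2 * p + 1) * (a ^ (2 * p) + b ^ (2 * p)) := by
    have hrefl := sum_range_reflect (fun i => a ^ i * b ^ (2 * p - i)) (2 * p + 1)
    rw [mul_two]
    nth_rewrite 2 [← hrefl]
    rw [← sum_add_distrib]
    calc _ ≤ ∑ i ∈ range (2 * p + 1), (a ^ (2 * p) + b ^ (2 * p)) := sum_le_sum fun i hi => ?_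
      _ = _ := by simp; ring
    obtain ⟨j, hj⟩ : ∃ j, i + j = 2 * p := ⟨2 * p - i, by simp at hi; omega⟩
    have e1 : 2 * p + 1 - 1 - i = j := by omega
    have e2 : 2 * p - j = i := by omega
    have e3 : 2 * p - i = j := by omega
    rw [e1, e2, e3, ← hj]
    have habs : |a| ^ i * |b| ^ j + |a| ^ j * |b| ^ i ≤ |a| ^ (i + j) + |b| ^ (i + j) := by
      have : 0 ≤ (|a| ^ i - |b| ^ i) * (|a| ^ j - |b| ^ j) := by
        rcases le_total |a| |b| with h | h
        · exact mul_nonneg_of_nonpos_of_nonpos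
            (sub_nonpos.2 (by gcongr)) (sub_nonpos.2 (by gcongr))
        · exact mul_nonneg (sub_nonneg.2 (by gcongr)) (sub_nonneg.2 (by gcongr))
      rw [pow_add, pow_add]
      linarith
    have ev : Even (i + j) := by rw [hj]; exact even_two_mul p
    rw [ev.pow_abs, ev.pow_abs] at habs
    refine le_trans (add_le_add ?_ ?_) habs
    · exact (le_abs_self _).trans (by rw [abs_mul, abs_pow, abs_pow])
    · exact (le_abs_self _).trans (by rw [abs_mul, abs_pow, abs_pow])
  have hg := (Commute.all a b).geom_sum₂_mul (2 * p + 1)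
  simp only [Nat.add_sub_cancel] at hg
  rw [← hg]
  linarith [mul_le_mul_of_nonneg_right hs (sq_nonneg (a - b))]

/-- Mean value trace inequality for odd powers of symmetric matrices. -/
lemma trace_sub_mul_pow_sub_pow_le {A B : Matrix ι ι ℝ} (hA : Aᵀ = A) (hB : Bᵀ = B) (p : ℕ) :
    trace ((A - B) * (A ^ (2 * p + 1) - B ^ (2 * p + 1))) ≤
      (2 * p + 1) / 2 * trace ((A - B) * (A - B) * (A ^ (2 * p) + B ^ (2 * p))) := by
  obtain ⟨a, b, w, hw, h⟩ := exists_trace_pow_mul_pow_eq_sum hA hB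
  have e1 : trace ((A - B) * (A ^ (2 * p + 1) - B ^ (2 * p + 1))) =
      trace (A ^ (2 * p + 2) * B ^ 0) - trace (A ^ 1 * B ^ (2 * p + 1)) -
        trace (A ^ (2 * p + 1) * B ^ 1) + trace (A ^ 0 * B ^ (2 * p + 2)) := by
    have c := trace_mul_comm B (A ^ (2 * p + 1))
    simp only [Matrix.sub_mul, Matrix.mul_sub, trace_sub, c, pow_zero, pow_one, Matrix.mul_one,
      Matrix.one_mul, ← pow_succ']
    ring
  have e2 : trace ((A - B) * (A - B) * (A ^ (2 * p) + B ^ (2 * p))) =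
      trace (A ^ (2 * p + 2) * B ^ 0) - 2 * trace (A ^ (2 * p + 1) * B ^ 1) +
        trace (A ^ (2 * p) * B ^ 2) + trace (A ^ 2 * B ^ (2 * p)) -
        2 * trace (A ^ 1 * B ^ (2 * p + 1)) + trace (A ^ 0 * B ^ (2 * p + 2)) := by
    have c1 : trace (A * B * A ^ (2 * p)) = trace (A ^ (2 * p + 1) * B) := by
      rw [trace_mul_comm, ← Matrix.mul_assoc, ← pow_succ]
    have c2 : trace (B * A * A ^ (2 * p)) = trace (A ^ (2 * p + 1) * B) := by
      rw [Matrix.mul_assoc, trace_mul_comm, ← pow_succ']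
    have c3 : trace (B * B * A ^ (2 * p)) = trace (A ^ (2 * p) * B ^ 2) := by
      rw [trace_mul_comm, sq]
    have c4 : trace (A * B * B ^ (2 * p)) = trace (A * B ^ (2 * p + 1)) := by
      rw [Matrix.mul_assoc, ← pow_succ']
    have c5 : trace (B * A * B ^ (2 * p)) = trace (A * B ^ (2 * p + 1)) := by
      rw [Matrix.mul_assoc, trace_mul_comm, Matrix.mul_assoc, ← pow_succ]
    have c6 : A * A * A ^ (2 * p) = A ^ (2 * p + 2) := by
      rw [Matrix.mul_assoc, ← pow_succ', ← pow_succ']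
    have c7 : B * B * B ^ (2 * p) = B ^ (2 * p + 2) := by
      rw [Matrix.mul_assoc, ← pow_succ', ← pow_succ']
    simp only [Matrix.sub_mul, Matrix.mul_sub, Matrix.mul_add, trace_sub, trace_add, c1, c2, c3,
      c4, c5, c6, c7, pow_zero, pow_one, Matrix.mul_one, Matrix.one_mul, sq A]
    ring
  rw [e1, e2]
  simp only [h, mul_sum, ← sum_add_distrib, ← sum_sub_distrib]
  refine sum_le_sum fun i _ => sum_le_sum fun j _ => ?_
  have := mul_le_mul_of_nonneg_left (sub_mul_pow_sub_pow_le p (a i) (b j)) (hw i j)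
  linear_combination this

open scoped Matrix.Norms.L2Operator in
lemma specNorm_lt_of_trace_pow_lt {A : Matrix ι ι ℝ} (hA : Aᵀ = A) (p : ℕ) {c : ℝ} (hc : 0 < c)
    (h : trace (A ^ (2 * p)) < c ^ (2 * p)) : specNorm A < c := by
  obtain ⟨Q, a, h1, h2, hk⟩ := exists_orthogonal_diagonalization hA
  have ha : ∀ i, |a i| < c := fun i => by
    rw [hk, trace_mul_comm, ← Matrix.mul_assoc, h2, Matrix.one_mul, trace_diagonal] at h
    have hi : a i ^ (2 * p) ≤ ∑ j, a j ^ (2 * p) :=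
      single_le_sum (f := fun j => a j ^ (2 * p))
        (fun j _ => (even_two_mul p).pow_nonneg _) (mem_univ i)
    refine lt_of_pow_lt_pow_left₀ (2 * p) hc.le ?_
    rw [(even_two_mul p).pow_abs]
    exact hi.trans_lt h
  have hQ : ‖Q‖ ≤ 1 := by
    have := l2_opNorm_conjTranspose_mul_self Q
    rw [conjTranspose_eq_transpose_of_trivial, h2, ← diagonal_one, l2_opNorm_diagonal] at this
    have h' : ‖(fun _ : ι => (1 : ℝ))‖ ≤ 1 := (pi_norm_le_iff_of_nonneg zero_le_one).2 (by simp)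
    nlinarith
  have hA' : ‖A‖ ≤ ‖a‖ := by
    have hQt : ‖Qᵀ‖ ≤ 1 := by
      rwa [← conjTranspose_eq_transpose_of_trivial, l2_opNorm_conjTranspose]
    have := hk 1
    simp only [pow_one] at this
    rw [this]
    calc _ ≤ ‖Q‖ * ‖diagonal a‖ * ‖Qᵀ‖ :=
          (l2_opNorm_mul _ _).trans (by gcongr; exact l2_opNorm_mul _ _)
      _ ≤ 1 * ‖a‖ * 1 := by rw [l2_opNorm_diagonal]; gcongr
      _ = ‖a‖ := by ring
  calc specNorm A = ‖A‖ := rfl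
    _ ≤ ‖a‖ := hA'
    _ < c := (pi_norm_lt_iff hc).2 ha

end TraceInequalities

/-- The centered sum `∑_{k ∈ Ω} u_k u_kᵀ - m I` of rank-one matrices sampled over `Ω`. -/
noncomputable def sampleDeviation {n : ℕ} {ι : Type*} [Fintype ι] [DecidableEq ι]
    (u : Fin n → ι → ℝ) (m : ℕ) (Ω : Finset (Fin n)) : Matrix ι ι ℝ :=
  ∑ k ∈ Ω, vecMulVec (u k) (u k) - (m : ℝ) • 1

section Sampling

variable {n : ℕ} {ι : Type*} [Fintype ι] [DecidableEq ι]

lemma transpose_sampleDeviation (u : Fin n → ι → ℝ) (m : ℕ) (Ω : Finset (Fin n)) :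
    (sampleDeviation u m Ω)ᵀ = sampleDeviation u m Ω := by
  simp [sampleDeviation, transpose_sum, transpose_vecMulVec]

lemma sampleDeviation_sub_map_swap (u : Fin n → ι → ℝ) (m : ℕ) (Ω : Finset (Fin n))
    (i j : Fin n) :
    sampleDeviation u m Ω - sampleDeviation u m (Ω.map (Equiv.swap i j).toEmbedding) =
      ((if i ∈ Ω then 1 else 0) - (if j ∈ Ω then 1 else 0) : ℝ) •
        (vecMulVec (u i) (u i) - vecMulVec (u j) (u j)) := by
  simp only [sampleDeviation, sum_map, sub_sub_sub_cancel_right, ← sum_sub_distrib]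
  rcases eq_or_ne i j with rfl | hij
  · simp
  have h : ∀ k, vecMulVec (u k) (u k) -
      vecMulVec (u (Equiv.swap i j k)) (u (Equiv.swap i j k)) =
      (if k = i then vecMulVec (u i) (u i) - vecMulVec (u j) (u j) else 0) -
      (if k = j then vecMulVec (u i) (u i) - vecMulVec (u j) (u j) else 0) := fun k => by
    rcases eq_or_ne k i with rfl | hi
    · simp [hij]
    rcases eq_or_ne k j with rfl | hj
    · simp [hi]
    · simp [hi, hj, Equiv.swap_apply_of_ne_of_ne hi hj]
  simp only [Equiv.coe_toEmbedding, h, sum_sub_distrib, sum_ite_eq', sub_smul, ite_smul, one_smul,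
    zero_smul]

/-- Exchangeability: swapping two fixed indices preserves the uniform distribution. -/
lemma sum_powersetCard_map_swap (m : ℕ) (i j : Fin n) (f : Finset (Fin n) → Finset (Fin n) → ℝ) :
    ∑ Ω ∈ powersetCard m univ, f (Ω.map (Equiv.swap i j).toEmbedding) Ω =
      ∑ Ω ∈ powersetCard m univ, f Ω (Ω.map (Equiv.swap i j).toEmbedding) := by
  have hinv : ∀ Ω : Finset (Fin n), (Ω.map (Equiv.swap i j).toEmbedding).map
      (Equiv.swap i j).toEmbedding = Ω := fun Ω => by
    ext k; simp
  refine sum_nbij' (fun Ω => Ω.map (Equiv.swap i j).toEmbedding)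
    (fun Ω => Ω.map (Equiv.swap i j).toEmbedding) ?_ ?_ ?_ ?_ ?_
  · intro Ω; simp [mem_powersetCard]
  · intro Ω; simp [mem_powersetCard]
  · intro Ω _; exact hinv Ω
  · intro Ω _; exact hinv Ω
  · intro Ω _; simp only [hinv]

lemma sum_indicator_eq_card {Ω : Finset (Fin n)} {m : ℕ} (hΩ : Ω ∈ powersetCard m univ) :
    ∑ i, (if i ∈ Ω then 1 else 0 : ℝ) = m := by
  simp [(mem_powersetCard.1 hΩ).2]

lemma sum_sum_indicator_add_mul_add {Ω : Finset (Fin n)} {m : ℕ} (hΩ : Ω ∈ powersetCard m univ)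
    (t : Fin n → ℝ) :
    ∑ i, ∑ j, ((if i ∈ Ω then 1 else 0) + (if j ∈ Ω then 1 else 0) : ℝ) * (t i + t j) =
      2 * (n * ∑ i ∈ Ω, t i + m * ∑ i, t i) := by
  have h : ∑ i, (if i ∈ Ω then 1 else 0 : ℝ) * t i = ∑ i ∈ Ω, t i := by simp
  simp only [add_mul, mul_add, sum_add_distrib, sum_const, ← mul_sum, ← sum_mul, h,
    sum_indicator_eq_card hΩ, card_univ, Fintype.card_fin, nsmul_eq_mul]
  ring

/-- The exchange operator reproduces the centered sum up to the factor `2 n`. -/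
lemma sum_sum_sampleDeviation_sub {u : Fin n → ι → ℝ}
    (hu : ∑ k, vecMulVec (u k) (u k) = (n : ℝ) • (1 : Matrix ι ι ℝ)) {m : ℕ}
    {Ω : Finset (Fin n)} (hΩ : Ω ∈ powersetCard m univ) :
    ∑ i, ∑ j, (sampleDeviation u m Ω -
      sampleDeviation u m (Ω.map (Equiv.swap i j).toEmbedding)) =
      (2 * n : ℝ) • sampleDeviation u m Ω := by
  have h : ∑ i, (if i ∈ Ω then 1 else 0 : ℝ) • vecMulVec (u i) (u i) =
      ∑ i ∈ Ω, vecMulVec (u i) (u i) := by simp [ite_smul]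
  simp only [sampleDeviation_sub_map_swap, sub_smul, smul_sub, sum_sub_distrib, sum_const,
    ← smul_sum, ← sum_smul, h, hu, sum_indicator_eq_card hΩ, card_univ, Fintype.card_fin]
  simp only [sampleDeviation, ← Nat.cast_smul_eq_nsmul ℝ]
  module

/-- Conditional variance bound for the exchange of two sampled indices. -/
lemma sum_sum_trace_sampleDeviation_sub_sq_le {u : Fin n → ι → ℝ}
    (hu : ∑ k, vecMulVec (u k) (u k) = (n : ℝ) • (1 : Matrix ι ι ℝ)) {K : ℝ}
    (hK : ∀ k, u k ⬝ᵥ u k ≤ K) {m : ℕ} {Ω : Finset (Fin n)} (hΩ : Ω ∈ powersetCard m univ)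
    {W : Matrix ι ι ℝ} (hW : Wᵀ = W) :
    ∑ i, ∑ j, trace ((sampleDeviation u m Ω -
        sampleDeviation u m (Ω.map (Equiv.swap i j).toEmbedding)) * (sampleDeviation u m Ω -
        sampleDeviation u m (Ω.map (Equiv.swap i j).toEmbedding)) * (W * W)) ≤
      4 * K * n * (trace (sampleDeviation u m Ω * (W * W)) + 2 * m * trace (W * W)) := by
  set t : Fin n → ℝ := fun k => trace (vecMulVec (u k) (u k) * (W * W)) with ht
  have ht0 : ∀ k, 0 ≤ t k := fun k => by
    simp only [ht, trace_vecMulVec_mul_sq hW]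
    exact sum_nonneg fun i _ => mul_self_nonneg _
  have hsum : ∑ k, t k = n * trace (W * W) := by
    simp only [ht, ← trace_sum, ← Matrix.sum_mul, hu, smul_mul, Matrix.one_mul, trace_smul,
      smul_eq_mul]
  have hsumΩ : ∑ k ∈ Ω, t k =
      trace (sampleDeviation u m Ω * (W * W)) + m * trace (W * W) := by
    simp only [ht, ← trace_sum, ← Matrix.sum_mul, sampleDeviation, Matrix.sub_mul, trace_sub,
      smul_mul, Matrix.one_mul, trace_smul, smul_eq_mul]
    ring
  have hX : ∀ k, trace (vecMulVec (u k) (u k) * vecMulVec (u k) (u k) * (W * W)) ≤ K * t k :=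
    fun k => by
    rw [vecMulVec_mul_vecMulVec, vecMulVec_smul, smul_mul, trace_smul]
    exact mul_le_mul_of_nonneg_right (hK k) (ht0 k)
  have hXX : ∀ i j, trace ((vecMulVec (u i) (u i) - vecMulVec (u j) (u j)) *
      (vecMulVec (u i) (u i) - vecMulVec (u j) (u j)) * (W * W)) ≤ 2 * K * (t i + t j) :=
    fun i j => by
    have h := trace_transpose_mul_self_nonneg
      ((vecMulVec (u i) (u i) + vecMulVec (u j) (u j)) * W)
    rw [transpose_mul, hW, transpose_add, transpose_vecMulVec, transpose_vecMulVec,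
      Matrix.mul_assoc, trace_mul_comm] at h
    have hi := hX i
    have hj := hX j
    simp only [Matrix.sub_mul, Matrix.mul_sub, Matrix.add_mul, Matrix.mul_add, trace_sub,
      trace_add, Matrix.mul_assoc] at h hi hj ⊢
    linarith
  calc _ ≤ ∑ i, ∑ j, 2 * K * (((if i ∈ Ω then 1 else 0) + (if j ∈ Ω then 1 else 0) : ℝ) *
        (t i + t j)) := sum_le_sum fun i _ => sum_le_sum fun j _ => ?_
    _ = _ := by
      simp only [← mul_sum]
      rw [sum_sum_indicator_add_mul_add hΩ, hsum, hsumΩ]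
      ring
  rw [sampleDeviation_sub_map_swap, smul_mul, Matrix.mul_smul, smul_mul, smul_mul, trace_smul,
    trace_smul,   smul_eq_mul, smul_eq_mul]
  have h0 : 0 ≤ 2 * K * (t i + t j) := by
    have : 0 ≤ K := (sum_nonneg fun _ _ => mul_self_nonneg _).trans (hK i)
    have := ht0 i
    have := ht0 j
    positivity
  have := hXX i j
  split_ifs <;> linarith

/-- One step of the even trace moment recursion. -/
lemma sum_trace_sampleDeviation_pow_succ_le {u : Fin n → ι → ℝ} (hn : 0 < n)
    (hu : ∑ k, vecMulVec (u k) (u k) = (n : ℝ) • (1 : Matrix ι ι ℝ)) {K : ℝ}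
    (hK : ∀ k, u k ⬝ᵥ u k ≤ K) (m p : ℕ) :
    ∑ Ω ∈ powersetCard m univ, trace (sampleDeviation u m Ω ^ (2 * (p + 1))) ≤
      (((2 * p + 1) * K) ^ 2 + 4 * m * ((2 * p + 1) * K)) *
        ∑ Ω ∈ powersetCard m univ, trace (sampleDeviation u m Ω ^ (2 * p)) := by
  set Y := sampleDeviation u m
  have hYt : ∀ Ω, (Y Ω)ᵀ = Y Ω := transpose_sampleDeviation u m
  have hsq : ∀ Ω, Y Ω ^ (2 * p) = Y Ω ^ p * Y Ω ^ p := fun Ω => by rw [← pow_add, two_mul]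
  have hWt : ∀ Ω, (Y Ω ^ p)ᵀ = Y Ω ^ p := fun Ω => by rw [transpose_pow, hYt]
  set σ : Fin n → Fin n → Finset (Fin n) → Finset (Fin n) :=
    fun i j Ω => Ω.map (Equiv.swap i j).toEmbedding
  have hexch : ∀ i j, ∑ Ω ∈ powersetCard m univ,
      trace ((Y Ω - Y (σ i j Ω)) * Y Ω ^ (2 * p + 1)) ≤
      (2 * p + 1) / 2 * ∑ Ω ∈ powersetCard m univ,
        trace ((Y Ω - Y (σ i j Ω)) * (Y Ω - Y (σ i j Ω)) * (Y Ω ^ p * Y Ω ^ p)) := fun i j => by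
    have s1 := sum_powersetCard_map_swap m i j
      (fun Ω Ω' => trace ((Y Ω - Y Ω') * Y Ω ^ (2 * p + 1)))
    have s2 := sum_powersetCard_map_swap m i j
      (fun Ω Ω' => trace ((Y Ω - Y Ω') * (Y Ω - Y Ω') * (Y Ω ^ p * Y Ω ^ p)))
    have s3 : ∑ Ω ∈ powersetCard m univ,
        trace ((Y Ω - Y (σ i j Ω)) * (Y Ω ^ (2 * p + 1) - Y (σ i j Ω) ^ (2 * p + 1))) ≤
        ∑ Ω ∈ powersetCard m univ, (2 * p + 1) / 2 *
          trace ((Y Ω - Y (σ i j Ω)) * (Y Ω - Y (σ i j Ω)) *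
            (Y Ω ^ (2 * p) + Y (σ i j Ω) ^ (2 * p))) :=
      sum_le_sum fun Ω _ => trace_sub_mul_pow_sub_pow_le (hYt _) (hYt _) p
    have e1 : ∀ Ω, trace ((Y Ω - Y (σ i j Ω)) *
        (Y Ω ^ (2 * p + 1) - Y (σ i j Ω) ^ (2 * p + 1))) =
        trace ((Y Ω - Y (σ i j Ω)) * Y Ω ^ (2 * p + 1)) +
        trace ((Y (σ i j Ω) - Y Ω) * Y (σ i j Ω) ^ (2 * p + 1)) := fun Ω => by
      simp only [Matrix.sub_mul, Matrix.mul_sub, trace_sub]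
      ring
    have e2 : ∀ Ω, trace ((Y Ω - Y (σ i j Ω)) * (Y Ω - Y (σ i j Ω)) *
        (Y Ω ^ (2 * p) + Y (σ i j Ω) ^ (2 * p))) =
        trace ((Y Ω - Y (σ i j Ω)) * (Y Ω - Y (σ i j Ω)) * (Y Ω ^ p * Y Ω ^ p)) +
        trace ((Y (σ i j Ω) - Y Ω) * (Y (σ i j Ω) - Y Ω) *
          (Y (σ i j Ω) ^ p * Y (σ i j Ω) ^ p)) := fun Ω => by
      rw [hsq, hsq, Matrix.mul_add, trace_add, ← neg_sub (Y Ω) (Y (σ i j Ω)), neg_mul_neg]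
    simp only [e1, e2, ← mul_sum, sum_add_distrib] at s3
    rw [s1, s2] at s3
    linarith
  have hstep : ∀ Ω ∈ powersetCard m (univ : Finset (Fin n)),
      2 * n * trace (Y Ω ^ (2 * (p + 1))) =
        ∑ i, ∑ j, trace ((Y Ω - Y (σ i j Ω)) * Y Ω ^ (2 * p + 1)) := fun Ω hΩ => by
    simp only [← trace_sum, ← Matrix.sum_mul]
    rw [sum_sum_sampleDeviation_sub hu hΩ, smul_mul, trace_smul, smul_eq_mul, ← pow_succ']
    rfl
  have hvar : ∀ Ω ∈ powersetCard m (univ : Finset (Fin n)),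
      ∑ i, ∑ j, trace ((Y Ω - Y (σ i j Ω)) * (Y Ω - Y (σ i j Ω)) * (Y Ω ^ p * Y Ω ^ p)) ≤
        4 * K * n * (trace (Y Ω * (Y Ω ^ p * Y Ω ^ p)) + 2 * m * trace (Y Ω ^ p * Y Ω ^ p)) :=
    fun Ω hΩ => sum_sum_trace_sampleDeviation_sub_sq_le hu hK hΩ (hWt Ω)
  have hn' : (0 : ℝ) < n := by exact_mod_cast hn
  set s : ℝ := (2 * p + 1) * K with hs
  have hmain : 2 * n * ∑ Ω ∈ powersetCard m univ, trace (Y Ω ^ (2 * (p + 1))) ≤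
      2 * n * ∑ Ω ∈ powersetCard m univ,
        s * (trace (Y Ω * (Y Ω ^ p * Y Ω ^ p)) + 2 * m * trace (Y Ω ^ p * Y Ω ^ p)) := by
    calc _ = ∑ i, ∑ j, ∑ Ω ∈ powersetCard m univ,
          trace ((Y Ω - Y (σ i j Ω)) * Y Ω ^ (2 * p + 1)) := by
          rw [mul_sum, sum_congr rfl hstep, sum_comm]
          exact sum_congr rfl fun i _ => sum_comm
      _ ≤ ∑ i, ∑ j, (2 * p + 1) / 2 * ∑ Ω ∈ powersetCard m univ,
          trace ((Y Ω - Y (σ i j Ω)) * (Y Ω - Y (σ i j Ω)) * (Y Ω ^ p * Y Ω ^ p)) :=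
          sum_le_sum fun i _ => sum_le_sum fun j _ => hexch i j
      _ = (2 * p + 1) / 2 * ∑ Ω ∈ powersetCard m univ, ∑ i, ∑ j,
          trace ((Y Ω - Y (σ i j Ω)) * (Y Ω - Y (σ i j Ω)) * (Y Ω ^ p * Y Ω ^ p)) := by
          simp only [← mul_sum]
          rw [sum_comm]
          congr 1
          rw [sum_comm, sum_comm (s := powersetCard m univ)]
          exact sum_congr rfl fun i _ => sum_comm
      _ ≤ (2 * p + 1) / 2 * ∑ Ω ∈ powersetCard m univ, 4 * K * n *
          (trace (Y Ω * (Y Ω ^ p * Y Ω ^ p)) + 2 * m * trace (Y Ω ^ p * Y Ω ^ p)) := by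
          gcongr with Ω hΩ
          exact hvar Ω hΩ
      _ = _ := by
          simp only [← mul_sum, hs]
          ring
  have hamgm : ∀ Ω, s * (trace (Y Ω * (Y Ω ^ p * Y Ω ^ p)) +
      2 * m * trace (Y Ω ^ p * Y Ω ^ p)) ≤
      (1 / 2) * trace (Y Ω ^ (2 * (p + 1))) +
        (s ^ 2 / 2 + 2 * m * s) * trace (Y Ω ^ (2 * p)) := fun Ω => by
    have h := trace_transpose_mul_self_nonneg (Y Ω * Y Ω ^ p - s • Y Ω ^ p)
    have c1 : Y Ω ^ (2 * (p + 1)) = Y Ω ^ (p + 1) * Y Ω ^ (p + 1) := by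
      rw [← pow_add]; congr 1; ring
    have c2 : Y Ω * (Y Ω ^ p * Y Ω ^ p) = Y Ω ^ (p + 1) * Y Ω ^ p := by
      rw [← Matrix.mul_assoc, ← pow_succ']
    rw [← pow_succ', transpose_sub, transpose_smul, hWt, transpose_pow, hYt] at h
    simp only [Matrix.sub_mul, Matrix.mul_sub, trace_sub, smul_mul, Matrix.mul_smul, trace_smul,
      smul_eq_mul, trace_mul_comm (Y Ω ^ p) (Y Ω ^ (p + 1))] at h
    rw [c1, c2, hsq]
    linarith
  have hfin := sum_le_sum fun Ω (_ : Ω ∈ powersetCard m (univ : Finset (Fin n))) => hamgm Ω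
  have := (le_of_mul_le_mul_left hmain (by positivity)).trans hfin
  rw [sum_add_distrib, ← mul_sum, ← mul_sum] at this
  linarith

lemma sum_trace_sampleDeviation_pow_le {u : Fin n → ι → ℝ} (hn : 0 < n)
    (hu : ∑ k, vecMulVec (u k) (u k) = (n : ℝ) • (1 : Matrix ι ι ℝ)) {K : ℝ} (hK0 : 0 ≤ K)
    (hK : ∀ k, u k ⬝ᵥ u k ≤ K) (m : ℕ) {R : ℝ} (p : ℕ) (hp : 2 * p * K ≤ R) :
    ∑ Ω ∈ powersetCard m univ, trace (sampleDeviation u m Ω ^ (2 * p)) ≤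
      (R ^ 2 + 4 * m * R) ^ p *
        ((powersetCard m (univ : Finset (Fin n))).card * Fintype.card ι) := by
  have hR : 0 ≤ R := le_trans (by positivity) hp
  induction p with
  | zero => simp
  | succ p ih =>
    have hs : (2 * p + 1) * K ≤ R := by push_cast at hp; linarith
    have hM : 0 ≤ ∑ Ω ∈ powersetCard m univ, trace (sampleDeviation u m Ω ^ (2 * p)) :=
      sum_nonneg fun Ω _ => by
        have := trace_transpose_mul_self_nonneg (sampleDeviation u m Ω ^ p)
        rwa [transpose_pow, transpose_sampleDeviation, ← pow_add, ← two_mul] at this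
    calc _ ≤ _ := sum_trace_sampleDeviation_pow_succ_le hn hu hK m p
      _ ≤ (R ^ 2 + 4 * m * R) *
          ∑ Ω ∈ powersetCard m univ, trace (sampleDeviation u m Ω ^ (2 * p)) := by gcongr
      _ ≤ _ := by
        have hp' : 2 * p * K ≤ R := by linarith
        rw [pow_succ' (R ^ 2 + 4 * m * R), mul_assoc (_ + _)]
        exact mul_le_mul_of_nonneg_left (ih hp') (by positivity)

/-- Tail bound for the spectral norm of sums of rank-one matrices sampled without replacement. -/
lemma uprob_half_le_specNorm_sampleDeviation_le {u : Fin n → ι → ℝ} (hn : 0 < n)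
    (hu : ∑ k, vecMulVec (u k) (u k) = (n : ℝ) • (1 : Matrix ι ι ℝ)) {K : ℝ} (hK0 : 0 ≤ K)
    (hK : ∀ k, u k ⬝ᵥ u k ≤ K) {m : ℕ} (hm : 0 < m) (p : ℕ) (hp : 80 * p * K ≤ m) :
    uprob (powersetCard m (univ : Finset (Fin n)))
      (fun Ω => 1 / 2 ≤ specNorm ((1 / (m : ℝ)) • sampleDeviation u m Ω)) ≤
      Fintype.card ι * (1 / 2) ^ p := by
  set P := powersetCard m (univ : Finset (Fin n))
  have hm' : (0 : ℝ) < m := by exact_mod_cast hm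
  have hmom := sum_trace_sampleDeviation_pow_le hn hu hK0 hK m (R := m / 40) p (by linarith)
  set E : Finset (Fin n) → Prop :=
    fun Ω => 1 / 2 ≤ specNorm ((1 / (m : ℝ)) • sampleDeviation u m Ω)
  have hmarkov : ((P.filter E).card : ℝ) * (m ^ 2 / 4) ^ p ≤
      ∑ Ω ∈ P, trace (sampleDeviation u m Ω ^ (2 * p)) := by
    calc _ = ∑ Ω ∈ P.filter E, ((m : ℝ) ^ 2 / 4) ^ p := by rw [sum_const, nsmul_eq_mul]
      _ ≤ ∑ Ω ∈ P.filter E, trace (sampleDeviation u m Ω ^ (2 * p)) :=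
        sum_le_sum fun Ω hΩ => ?_
      _ ≤ _ := sum_le_sum_of_subset_of_nonneg (filter_subset _ _) fun Ω _ _ => by
        have := trace_transpose_mul_self_nonneg (sampleDeviation u m Ω ^ p)
        rwa [transpose_pow, transpose_sampleDeviation, ← pow_add, ← two_mul] at this
    by_contra! hlt
    refine (mem_filter.1 hΩ).2.not_gt
      (specNorm_lt_of_trace_pow_lt (by simp [transpose_sampleDeviation]) p (by norm_num) ?_)
    rw [smul_pow, trace_smul, smul_eq_mul]
    calc _ < (1 / (m : ℝ)) ^ (2 * p) * (m ^ 2 / 4) ^ p := by gcongr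
      _ = _ := by
        rw [pow_mul, pow_mul, ← mul_pow]
        congr 1
        field_simp
        norm_num
  have hratio : ((m / 40 : ℝ) ^ 2 + 4 * m * (m / 40)) ^ p ≤ (m ^ 2 / 4) ^ p * (1 / 2) ^ p := by
    rw [← mul_pow]
    gcongr
    nlinarith
  rw [uprob]
  refine div_le_of_le_mul₀ (by positivity) (by positivity) ?_
  refine le_of_mul_le_mul_right (a := ((m : ℝ) ^ 2 / 4) ^ p) ?_ (by positivity)
  calc _ ≤ _ := hmarkov.trans hmom
    _ ≤ (m ^ 2 / 4) ^ p * (1 / 2) ^ p * (P.card * Fintype.card ι) := by gcongr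
    _ = _ := by ring

end Sampling

lemma abs_apply_le_coh {n : ℕ} (U : Matrix (Fin n) (Fin n) ℝ) (k j : Fin n) :
    |U k j| ≤ coh U :=
  (le_ciSup (f := fun j => |U k j|) (Set.finite_range _).bddAbove j).trans
    (le_ciSup (f := fun k => ⨆ j, |U k j|) (Set.finite_range _).bddAbove k)

lemma coh_pos {n : ℕ} (hn : 0 < n) {U : Matrix (Fin n) (Fin n) ℝ}
    (hU : Uᵀ * U = (n : ℝ) • (1 : Matrix (Fin n) (Fin n) ℝ)) : 0 < coh U := by
  by_contra! h
  have hz : U = 0 := by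
    ext k j
    exact abs_nonpos_iff.1 ((abs_apply_le_coh U k j).trans h)
  have := congrFun (congrFun hU ⟨0, hn⟩) ⟨0, hn⟩
  simp [hz, eq_comm, hn.ne'] at this

/-- The choice of moment order: a geometric tail turns into the failure probability `δ`. -/
lemma exists_nat_mul_half_pow_le {d : ℕ} (hd : 0 < d) {K x δ : ℝ} (hK : 0 < K) (hδ : 0 < δ)
    (h : K * max (400 * log d) (400 * log (3 / δ)) ≤ x) :
    ∃ p : ℕ, 80 * p * K ≤ x ∧ d * (1 / 2 : ℝ) ^ p ≤ δ := by
  have hd' : (1 : ℝ) ≤ d := by exact_mod_cast hd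
  have hlogd : 0 ≤ log d := log_nonneg hd'
  have hl : max (400 * log d) (400 * log (3 / δ)) ≤ x / K := by
    rw [le_div_iff₀ hK]; linarith
  have h1 := (le_max_left _ _).trans hl
  have h2 := (le_max_right _ _).trans hl
  have h0 : 0 ≤ x / K / 80 := by linarith
  refine ⟨⌊x / K / 80⌋₊, ?_, ?_⟩
  · have := Nat.floor_le h0
    rw [le_div_iff₀ (by norm_num), le_div_iff₀ hK] at this
    linarith
  · have hfl := Nat.lt_floor_add_one (x / K / 80)
    set p := ⌊x / K / 80⌋₊
    rw [← log_le_log_iff (by positivity) hδ, log_mul (by positivity) (by positivity), log_pow,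
      one_div, log_inv]
    rw [log_div (by norm_num) hδ.ne'] at h2
    have hl2 : 0.6931 < log 2 := by linarith [log_two_gt_d9]
    have hl3 : log 2 ≤ log 3 := log_le_log (by norm_num) (by norm_num)
    have hp : (x / K / 80 - 1) * log 2 ≤ p * log 2 := by
      apply mul_le_mul_of_nonneg_right _ (by linarith)
      linarith
    have hp' : x / K / 80 * 0.6931 ≤ x / K / 80 * log 2 :=
      mul_le_mul_of_nonneg_left hl2.le h0
    linarith

/-- Theorem 1.2.  There are absolute constants `C₁, C₂ > 0`
such that: for `U` with `UᵀU = n•I`, a fixed `T`, `δ ∈ (0,1)`, and a uniformly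
random subset `Ω` of size `m`, if `m ≥ |T|·μ(U)²·max(C₁ log|T|, C₂ log(3/δ))`
then `P(‖(1/m) U_{ΩT}ᵀ U_{ΩT} - I‖ ≥ 1/2) ≤ δ`. -/
theorem statement2 :
    ∃ C₁ C₂ : ℝ, 0 < C₁ ∧ 0 < C₂ ∧
      ∀ (n m : ℕ) (U : Matrix (Fin n) (Fin n) ℝ),
        Uᵀ * U = (n : ℝ) • (1 : Matrix (Fin n) (Fin n) ℝ) →
        ∀ (T : Finset (Fin n)) (δ : ℝ),
          0 < δ → δ < 1 → 0 < m → m ≤ n →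
          (T.card : ℝ) * coh U ^ 2 *
              max (C₁ * Real.log T.card) (C₂ * Real.log (3 / δ)) ≤ m →
          uprob (Finset.powersetCard m (Finset.univ : Finset (Fin n)))
              (fun Ω =>
                (1 : ℝ) / 2 ≤
                  specNorm
                    ((1 / (m : ℝ)) •
                        ((Matrix.of fun (i : ↥Ω) (t : ↥T) => U i.1 t.1)ᵀ *
                          Matrix.of fun (i : ↥Ω) (t : ↥T) => U i.1 t.1) -
                      (1 : Matrix ↥T ↥T ℝ))) ≤ δ := by
  refine ⟨400, 400, by norm_num, by norm_num, ?_⟩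
  intro n m U hU T δ hδ _ hm hmn hbound
  have hn : 0 < n := hm.trans_le hmn
  have hm' : (0 : ℝ) < m := by exact_mod_cast hm
  set u : Fin n → T → ℝ := fun k t => U k t.1 with hu_def
  set K : ℝ := T.card * coh U ^ 2 with hK_def
  have hu : ∑ k, vecMulVec (u k) (u k) = (n : ℝ) • (1 : Matrix T T ℝ) := by
    ext s t
    have := congrFun (congrFun hU s.1) t.1
    simp only [mul_apply, transpose_apply, Matrix.smul_apply, one_apply] at this
    simp only [Matrix.sum_apply, vecMulVec_apply, Matrix.smul_apply, one_apply, hu_def,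
      Subtype.ext_iff]
    exact this
  have hK : ∀ k, u k ⬝ᵥ u k ≤ K := fun k => by
    calc u k ⬝ᵥ u k ≤ ∑ _t : T, coh U ^ 2 := sum_le_sum fun t _ => by
          rw [← sq, ← sq_abs]
          exact pow_le_pow_left₀ (abs_nonneg _) (abs_apply_le_coh U k t.1) 2
      _ = K := by simp [hK_def]
  have hmat : ∀ Ω : Finset (Fin n),
      (1 / (m : ℝ)) • ((Matrix.of fun (i : ↥Ω) (t : ↥T) => U i.1 t.1)ᵀ *
        Matrix.of fun (i : ↥Ω) (t : ↥T) => U i.1 t.1) - (1 : Matrix ↥T ↥T ℝ) =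
      (1 / (m : ℝ)) • sampleDeviation u m Ω := fun Ω => by
    have hS : (Matrix.of fun (i : ↥Ω) (t : ↥T) => U i.1 t.1)ᵀ *
        (Matrix.of fun (i : ↥Ω) (t : ↥T) => U i.1 t.1) = ∑ k ∈ Ω, vecMulVec (u k) (u k) := by
      ext s t
      simp only [mul_apply, transpose_apply, of_apply, Matrix.sum_apply, vecMulVec_apply, hu_def]
      exact sum_coe_sort Ω fun k => U k s.1 * U k t.1
    rw [hS, sampleDeviation, smul_sub, smul_smul, one_div_mul_cancel hm'.ne', one_smul]
  simp only [hmat]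
  have htail := fun p hp => uprob_half_le_specNorm_sampleDeviation_le (u := u) hn hu
    (by positivity : 0 ≤ K) hK hm p hp
  rw [Fintype.card_coe] at htail
  rcases T.card.eq_zero_or_pos with hT | hT
  · refine (htail 0 (by simp)).trans ?_
    simp [hT, hδ.le]
  · have hKpos : 0 < K := mul_pos (by exact_mod_cast hT) (pow_pos (coh_pos hn hU) 2)
    obtain ⟨p, hp, hpδ⟩ := exists_nat_mul_half_pow_le hT hKpos hδ hbound
    exact (htail p hp).trans hpδ
end

section
/- Let U be an n×n real matrix with UᵀU = n·I, fix T ⊆ {1,…,n}, let u^k = (U_{k,t})_{t∈T}, and let δ₁,…,δ_n be i.i.d. Bernoulli random variables with P(δ_k = 1) = m/n. For k = 1,…,n set Y_k = (δ_k − m/n) · (u^k ⊗ u^k)/m. Then for all unit vectors f₁, f₂ ∈ ℝ^{|T|}: (i) |⟨f₁, Y_k f₂⟩| ≤ max_{1≤j≤n} ‖u^j‖² / m for every k, and (ii) Σ_{k=1}^n E ⟨f₁, Y_k f₂⟩² ≤ (1 − m/n) · (1/m) · max_{1≤j≤n} ‖u^j‖². -/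
open Classical Finset Matrix Real

theorem dotProduct_smul_vecMulVec_mulVec {ι : Type*} [Fintype ι] (c : ℝ) (f u g : ι → ℝ) :
    f ⬝ᵥ ((c • Matrix.vecMulVec u u).mulVec g) = c * ((f ⬝ᵥ u) * (u ⬝ᵥ g)) := by
  rw [Matrix.smul_mulVec, Matrix.vecMulVec_mulVec, dotProduct_smul, op_smul_eq_smul,
    dotProduct_smul, smul_eq_mul, smul_eq_mul]
  ring

theorem sq_dotProduct_le_of_sum_sq_eq_one {ι : Type*} [Fintype ι] (f u : ι → ℝ)
    (hf : ∑ t, f t ^ 2 = 1) : (f ⬝ᵥ u) ^ 2 ≤ ∑ t, u t ^ 2 := by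
  simpa [hf, dotProduct] using Finset.sum_mul_sq_le_sq_mul_sq Finset.univ f u

theorem sum_sq_dotProduct_of_transpose_mul_self {κ ι : Type*} [Fintype κ] [Fintype ι]
    [DecidableEq ι] (V : Matrix κ ι ℝ) (c : ℝ) (hV : Vᵀ * V = c • (1 : Matrix ι ι ℝ))
    (f : ι → ℝ) : ∑ k, (V k ⬝ᵥ f) ^ 2 = c * ∑ t, f t ^ 2 := by
  calc ∑ k, (V k ⬝ᵥ f) ^ 2 = (V *ᵥ f) ⬝ᵥ (V *ᵥ f) := by
        simp only [dotProduct, Matrix.mulVec, sq]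
    _ = f ⬝ᵥ ((Vᵀ * V) *ᵥ f) := by
        rw [← Matrix.mulVec_mulVec, Matrix.dotProduct_mulVec f, Matrix.vecMul_transpose]
    _ = c * ∑ t, f t ^ 2 := by
        rw [hV, Matrix.smul_mulVec, Matrix.one_mulVec, dotProduct_smul, smul_eq_mul]
        simp only [dotProduct, sq]

theorem transpose_mul_self_submatrix_columns {n : ℕ} (U : Matrix (Fin n) (Fin n) ℝ) (c : ℝ)
    (hU : Uᵀ * U = c • (1 : Matrix (Fin n) (Fin n) ℝ)) (T : Finset (Fin n)) :
    (U.submatrix id (Subtype.val : T → Fin n))ᵀ * U.submatrix id (Subtype.val : T → Fin n) =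
      c • (1 : Matrix T T ℝ) := by
  have h := Matrix.submatrix_mul_equiv Uᵀ U (Subtype.val : T → Fin n) (Equiv.refl (Fin n))
    (Subtype.val : T → Fin n)
  rw [hU, Matrix.submatrix_smul] at h
  refine h.trans ?_
  rw [Pi.smul_apply, Pi.smul_apply, Matrix.submatrix_one _ Subtype.val_injective]

/-- bounds on `B` and `σ²` in the proof of Theorem 1.2.  With
`u^k = (U_{k,t})_{t∈T}`, `Y_k = (δ_k - m/n)·(u^k ⊗ u^k)/m` for i.i.d.
Bernoulli(m/n) variables `δ_k`, and unit vectors `f₁, f₂`: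
(i) `|⟨f₁, Y_k f₂⟩| ≤ max_j ‖u^j‖²/m` for every outcome and every `k`, and
(ii) `Σ_k E⟨f₁, Y_k f₂⟩² ≤ (1 - m/n)·(1/m)·max_j ‖u^j‖²`
(the expectation over `δ_k ∈ {0,1}` is written out explicitly). -/
theorem statement7 (n m : ℕ) (U : Matrix (Fin n) (Fin n) ℝ)
    (hU : Uᵀ * U = (n : ℝ) • (1 : Matrix (Fin n) (Fin n) ℝ))
    (T : Finset (Fin n)) (hn : 0 < n) (hm : 0 < m) (hmn : m ≤ n)
    (f₁ f₂ : ↥T → ℝ) (hf₁ : ∑ t, f₁ t ^ 2 = 1) (hf₂ : ∑ t, f₂ t ^ 2 = 1) :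
    (∀ (ω : Fin n → Bool) (k : Fin n),
        |f₁ ⬝ᵥ (((((if ω k then (1 : ℝ) else 0) - (m : ℝ) / n) / m) •
              Matrix.vecMulVec (fun t : ↥T => U k t.1)
                (fun t : ↥T => U k t.1)).mulVec f₂)| ≤
          (⨆ j : Fin n, ∑ t : ↥T, U j t.1 ^ 2) / m) ∧
      ∑ k : Fin n,
          ((m : ℝ) / n *
              (f₁ ⬝ᵥ (((((1 : ℝ) - (m : ℝ) / n) / m) •
                    Matrix.vecMulVec (fun t : ↥T => U k t.1)
                      (fun t : ↥T => U k t.1)).mulVec f₂)) ^ 2 +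
            (1 - (m : ℝ) / n) *
              (f₁ ⬝ᵥ (((((0 : ℝ) - (m : ℝ) / n) / m) •
                    Matrix.vecMulVec (fun t : ↥T => U k t.1)
                      (fun t : ↥T => U k t.1)).mulVec f₂)) ^ 2) ≤
        (1 - (m : ℝ) / n) * (1 / m) * ⨆ j : Fin n, ∑ t : ↥T, U j t.1 ^ 2 := by
  set M : ℝ := ⨆ j : Fin n, ∑ t : ↥T, U j t.1 ^ 2
  have hrow (k : Fin n) : ∑ t : ↥T, U k t.1 ^ 2 ≤ M :=
    le_ciSup (f := fun j : Fin n => ∑ t : ↥T, U j t.1 ^ 2) (Set.finite_range _).bddAbove k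
  have hm' : (0 : ℝ) < m := by exact_mod_cast hm
  have hn' : (0 : ℝ) < n := by exact_mod_cast hn
  have hp0 : 0 ≤ (m : ℝ) / n := by positivity
  have hp1 : (m : ℝ) / n ≤ 1 := (div_le_one hn').2 (by exact_mod_cast hmn)
  have h₁ (k : Fin n) : (f₁ ⬝ᵥ fun t : ↥T => U k t.1) ^ 2 ≤ M :=
    (sq_dotProduct_le_of_sum_sq_eq_one f₁ _ hf₁).trans (hrow k)
  have h₂ (k : Fin n) : ((fun t : ↥T => U k t.1) ⬝ᵥ f₂) ^ 2 ≤ M := by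
    rw [dotProduct_comm]
    exact (sq_dotProduct_le_of_sum_sq_eq_one f₂ _ hf₂).trans (hrow k)
  have hsum : ∑ k : Fin n, ((fun t : ↥T => U k t.1) ⬝ᵥ f₂) ^ 2 = n := by
    have h := sum_sq_dotProduct_of_transpose_mul_self _ _
      (transpose_mul_self_submatrix_columns U n hU T) f₂
    rw [hf₂, mul_one] at h
    exact h
  simp only [dotProduct_smul_vecMulVec_mulVec]
  refine ⟨fun ω k => ?_, ?_⟩
  · have hc : |(if ω k then (1 : ℝ) else 0) - (m : ℝ) / n| ≤ 1 := by
      split_ifs <;> rw [abs_le] <;> constructor <;> linarith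
    have hab : |(f₁ ⬝ᵥ fun t : ↥T => U k t.1) * ((fun t : ↥T => U k t.1) ⬝ᵥ f₂)| ≤ M := by
      rw [abs_mul]
      nlinarith [h₁ k, h₂ k, sq_abs (f₁ ⬝ᵥ fun t : ↥T => U k t.1),
        sq_abs ((fun t : ↥T => U k t.1) ⬝ᵥ f₂),
        sq_nonneg (|f₁ ⬝ᵥ fun t : ↥T => U k t.1| - |(fun t : ↥T => U k t.1) ⬝ᵥ f₂|)]
    rw [abs_mul, abs_div, abs_of_pos hm', div_mul_eq_mul_div]
    gcongr
    exact (mul_le_of_le_one_left (abs_nonneg _) hc).trans hab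
  · calc _ ≤ ∑ k : Fin n, (1 - (m : ℝ) / n) * (1 / (m * n)) * M *
          ((fun t : ↥T => U k t.1) ⬝ᵥ f₂) ^ 2 := by
          refine Finset.sum_le_sum fun k _ => ?_
          have h := mul_le_mul_of_nonneg_right (h₁ k)
            (sq_nonneg ((fun t : ↥T => U k t.1) ⬝ᵥ f₂))
          have hcoef : 0 ≤ (1 - (m : ℝ) / n) * (1 / (m * n)) :=
            mul_nonneg (sub_nonneg.2 hp1) (by positivity)
          refine le_of_eq_of_le ?_ ((mul_le_mul_of_nonneg_left h hcoef).trans_eq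
            (mul_assoc _ _ _).symm)
          field_simp
          ring
      _ = (1 - (m : ℝ) / n) * (1 / m) * M := by
          rw [← Finset.mul_sum, hsum]
          field_simp
end
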